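/- There is no AME(4,6) state of minimal support; that is, there is no unit vector ψ : (Fin 4 → Fin 6) → ℂ which is an AME(4,6) state and whose support in the computational basis has exactly 36 elements. -/

import Mathlib

open scoped BigOperators Classical

noncomputable section

namespace AMEPaper

/-- Combine a configuration on the complement of `B` with a configuration on `B`
into a full configuration on `Fin n`. -/
def combine {n d : ℕ} (B : Finset (Fin n)) (a : {i : Fin n // i ∉ B} → Fin d)
    (b : {i : Fin n // i ∈ B} → Fin d) : Fin n → Fin d :=
  fun i => if h : i ∈ B then b ⟨i, h⟩ else a ⟨i, h⟩

/-- `ψ` is an absolutely maximally entangled state with `n` sites and local dimension `d`: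
it is a unit vector and, for every set `B` of at most `n/2` sites, the reduced density
matrix on `B` equals `d ^ (-|B|)` times the identity. -/
def IsAME (n d : ℕ) (ψ : (Fin n → Fin d) → ℂ) : Prop :=
  (∑ s : Fin n → Fin d, ‖ψ s‖ ^ 2 = 1) ∧
  ∀ B : Finset (Fin n), B.card ≤ n / 2 →
    ∀ b b' : {i : Fin n // i ∈ B} → Fin d,
      (∑ a : {i : Fin n // i ∉ B} → Fin d,
          ψ (combine B a b) * (starRingEnd ℂ) (ψ (combine B a b'))) =
        if b = b' then ((d : ℂ) ^ B.card)⁻¹ else 0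

/-- `ψ` has minimal support: its support in the computational basis has exactly
`d ^ ⌊n/2⌋` elements. -/
def HasMinimalSupport (n d : ℕ) (ψ : (Fin n → Fin d) → ℂ) : Prop :=
  {s : Fin n → Fin d | ψ s ≠ 0}.ncard = d ^ (n / 2)

/-- `C` is an MDS code over the alphabet `Fin d` with wordlength `n` and minimum
Hamming distance `δ`: its minimum distance is exactly `δ` and it meets the Singleton
bound, `|C| = d ^ (n - δ + 1)`. -/
def IsMDSCode (d n δ : ℕ) (C : Finset (Fin n → Fin d)) : Prop :=
  C.card = d ^ (n - δ + 1) ∧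
  (∀ w ∈ C, ∀ w' ∈ C, w ≠ w' → δ ≤ hammingDist w w') ∧
  (∃ w ∈ C, ∃ w' ∈ C, w ≠ w' ∧ hammingDist w w' = δ)

/-- A latin `k`-hypercube of order `d`: fixing all indices but any one of them, the
resulting map `Fin d → Fin d` is a bijection. -/
def IsLatinHypercube (k d : ℕ) (L : (Fin k → Fin d) → Fin d) : Prop :=
  ∀ (i : Fin k) (x : Fin k → Fin d),
    Function.Bijective fun v : Fin d => L (Function.update x i v)

/-- Two latin `k`-hypercubes are orthogonal if for every pair of distinct indices and
all ways of fixing the remaining indices, the two resulting latin squares are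
orthogonal. -/
def AreOrthogonalHypercubes (k d : ℕ) (L M : (Fin k → Fin d) → Fin d) : Prop :=
  ∀ (i j : Fin k), i ≠ j → ∀ x : Fin k → Fin d,
    Function.Injective fun p : Fin d × Fin d =>
      (L (Function.update (Function.update x i p.1) j p.2),
       M (Function.update (Function.update x i p.1) j p.2))

/-- A latin square of order `d`: every row and every column is a bijection. -/
def IsLatinSquare (d : ℕ) (L : Fin d × Fin d → Fin d) : Prop :=
  (∀ i : Fin d, Function.Bijective fun j => L (i, j)) ∧
  (∀ j : Fin d, Function.Bijective fun i => L (i, j))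

/-- Orthogonal array of strength two with four columns and six levels. -/
def IsOA (B : Fin 6 × Fin 6 → Fin 4 → Fin 6) : Prop :=
  ∀ i j : Fin 4, i ≠ j → Function.Bijective fun p => (B p i, B p j)

/-- Coordinate of an encoded block. -/
def coord (t : ℕ × ℕ × ℕ × ℕ) : ℕ → ℕ
  | 0 => t.1
  | 1 => t.2.1
  | 2 => t.2.2.1
  | _ => t.2.2.2

/-- Two blocks are compatible if they agree in at most one coordinate or in all of them. -/
def compat (s t : ℕ × ℕ × ℕ × ℕ) : Bool :=
  match (Nat.beq s.1 t.1).toNat + (Nat.beq s.2.1 t.2.1).toNat +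
    (Nat.beq s.2.2.1 t.2.2.1).toNat + (Nat.beq s.2.2.2 t.2.2.2).toNat with
  | 2 => false
  | 3 => false
  | _ => true

/-- Number of special coordinates is zero or two. -/
def evenOk (t : ℕ × ℕ × ℕ × ℕ) : Bool :=
  match (Nat.ble t.1 1).toNat + (Nat.ble t.2.1 1).toNat +
    (Nat.ble t.2.2.1 1).toNat + (Nat.ble t.2.2.2 1).toNat with
  | 0 => true
  | 2 => true
  | _ => false

/-- Backtracking search; `false` means that there is no completion. -/
def search : List (ℕ × ℕ × ℕ × ℕ) → List (ℕ × ℕ × ℕ × ℕ) → Bool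
  | [], _ => true
  | x :: xs, c => c.any fun t =>
      Nat.beq (coord t x.1) x.2.2.1 && (Nat.beq (coord t x.2.1) x.2.2.2 &&
        search xs (c.filter (compat t)))

/-- The order in which pairs of points are branched on. -/
def cells : List (ℕ × ℕ × ℕ × ℕ) :=
  [(0,2,0,0),(0,2,0,1),(0,2,1,0),(0,2,1,1),(0,3,0,0),(0,3,0,1),(0,3,1,0),(0,3,1,1),
   (1,2,0,0),(1,2,0,1),(1,2,1,0),(1,2,1,1),(1,3,0,0),(1,3,0,1),(1,3,1,0),(1,3,1,1),
   (0,1,2,3),(0,1,2,4),(0,1,2,5),(0,1,3,2),(0,1,3,4),(0,1,3,5),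
   (0,1,4,2),(0,1,4,3),(0,1,4,5),(0,1,5,2),(0,1,5,3),(0,1,5,4)]

/-- The blocks that may be assumed by relabelling. -/
def preset : List (ℕ × ℕ × ℕ × ℕ) :=
  [(0,0,2,2),(0,1,3,3),(1,0,4,4),(1,1,5,5),(2,2,0,0),(3,3,0,1),(4,4,1,0),(5,5,1,1)]

def six : List ℕ := [0,1,2,3,4,5]

def cands : List (ℕ × ℕ × ℕ × ℕ) :=
  ((six.flatMap fun a => six.flatMap fun b => six.flatMap fun c => six.map fun d => (a,b,c,d)).filter
    evenOk).filter fun t => preset.all fun s => compat s t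

theorem search_cells : search cells cands = false := by decide +kernel

/-- Encoding of a block as a tuple of numbers. -/
def enc (w : Fin 4 → Fin 6) : ℕ × ℕ × ℕ × ℕ := (w 0, w 1, w 2, w 3)

theorem compat_enc {B : Fin 6 × Fin 6 → Fin 4 → Fin 6} (hB : IsOA B) (p q) :
    compat (enc (B p)) (enc (B q)) = true := by
  by_cases hpq : p = q
  · subst hpq
    simp [compat]
  have key : ∀ i j : Fin 4, i ≠ j → ¬ (B p i = B q i ∧ B p j = B q j) := by
    intro i j hij h
    exact hpq ((hB i j hij).1 (Prod.ext h.1 h.2))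
  have k01 := key 0 1 (by decide)
  have k02 := key 0 2 (by decide)
  have k03 := key 0 3 (by decide)
  have k12 := key 1 2 (by decide)
  have k13 := key 1 3 (by decide)
  have k23 := key 2 3 (by decide)
  have e : ∀ i, Nat.beq (B p i) (B q i) = decide (B p i = B q i) := by
    intro i
    rw [Bool.eq_iff_iff]
    simp [Fin.ext_iff]
  simp only [compat, enc, e]
  by_cases h0 : B p 0 = B q 0 <;> by_cases h1 : B p 1 = B q 1 <;>
  by_cases h2 : B p 2 = B q 2 <;> by_cases h3 : B p 3 = B q 3 <;> simp_all

theorem search_sound {B : Fin 6 × Fin 6 → Fin 4 → Fin 6} (hB : IsOA B) :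
    ∀ (cs : List (ℕ × ℕ × ℕ × ℕ)), (∀ x ∈ cs, ∃ p, coord (enc (B p)) x.1 = x.2.2.1 ∧
      coord (enc (B p)) x.2.1 = x.2.2.2) → ∀ c, (∀ p, enc (B p) ∈ c) → search cs c = true := by
  intro cs
  induction cs with
  | nil => intros; rfl
  | cons x xs ih =>
    intro hx c hc
    obtain ⟨p, h1, h2⟩ := hx x (by simp)
    rw [search, List.any_eq_true]
    refine ⟨enc (B p), hc p, ?_⟩
    rw [Bool.and_eq_true, Bool.and_eq_true]
    refine ⟨by rw [h1]; simp, by rw [h2]; simp, ih (fun y hy => hx y (by simp [hy])) _ ?_⟩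
    intro q
    rw [List.mem_filter]
    exact ⟨hc q, compat_enc hB p q⟩

theorem coord_enc (w : Fin 4 → Fin 6) (i : Fin 4) : coord (enc w) i = w i := by
  fin_cases i <;> rfl

theorem cells_ok : ∀ x ∈ cells, ∃ (i j : Fin 4) (a b : Fin 6), i ≠ j ∧ x = ((i:ℕ),(j:ℕ),(a:ℕ),(b:ℕ)) := by
  have : ∀ x ∈ cells, x.1 < x.2.1 ∧ x.2.1 < 4 ∧ x.2.2.1 < 6 ∧ x.2.2.2 < 6 := by
    unfold cells
    simp
  intro x hx
  obtain ⟨h1, h2, h3, h4⟩ := this x hx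
  exact ⟨⟨x.1, by omega⟩, ⟨x.2.1, h2⟩, ⟨x.2.2.1, h3⟩, ⟨x.2.2.2, h4⟩, by simp [Fin.ext_iff]; omega, rfl⟩

theorem final {B : Fin 6 × Fin 6 → Fin 4 → Fin 6} (hB : IsOA B)
    (he : ∀ p, evenOk (enc (B p)) = true) (hp : ∀ t ∈ preset, ∃ p, enc (B p) = t) : False := by
  have h := search_sound hB cells ?_ cands ?_
  · rw [search_cells] at h
    exact Bool.noConfusion h
  · intro x hx
    obtain ⟨i, j, a, b, hij, rfl⟩ := cells_ok x hx
    obtain ⟨p, hp⟩ := (hB i j hij).2 (a, b)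
    rw [Prod.mk.injEq] at hp
    exact ⟨p, by simp only [coord_enc, hp], by simp only [coord_enc, hp]⟩
  · intro p
    unfold cands
    rw [List.mem_filter, List.mem_filter]
    refine ⟨⟨?_, he p⟩, ?_⟩
    · have h6 : ∀ a : Fin 6, (a : ℕ) ∈ six := by decide
      simp only [List.mem_flatMap, List.mem_map]
      exact ⟨_, h6 (B p 0), _, h6 (B p 1), _, h6 (B p 2), _, h6 (B p 3), rfl⟩
    · rw [List.all_eq_true]
      intro s hs
      obtain ⟨q, rfl⟩ := hp s hs
      exact compat_enc hB q p

theorem sum_pair {M : Type*} [AddCommMonoid M] {B : Fin 6 × Fin 6 → Fin 4 → Fin 6} (hB : IsOA B)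
    {i j : Fin 4} (hij : i ≠ j) (g : Fin 6 → Fin 6 → M) :
    ∑ p, g (B p i) (B p j) = ∑ a, ∑ b, g a b := by
  rw [← Fintype.sum_prod_type' g]
  exact (hB i j hij).sum_comp (fun x : Fin 6 × Fin 6 => g x.1 x.2)

theorem exists_ne_fin4 (i : Fin 4) : ∃ j, i ≠ j := by
  by_cases h : i = 0
  · exact ⟨1, by rw [h]; decide⟩
  · exact ⟨0, h⟩

theorem sum_single {M : Type*} [AddCommMonoid M] {B : Fin 6 × Fin 6 → Fin 4 → Fin 6} (hB : IsOA B)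
    (i : Fin 4) (g : Fin 6 → M) :
    ∑ p, g (B p i) = 6 • ∑ a, g a := by
  obtain ⟨j, hj⟩ := exists_ne_fin4 i
  rw [sum_pair hB hj (fun a _ => g a)]
  simp [Finset.smul_sum]

/-- The incidence map from point weights to block weights over the field of two elements. -/
def inc (B : Fin 6 × Fin 6 → Fin 4 → Fin 6) :
    (Fin 4 → Fin 6 → ZMod 2) →ₗ[ZMod 2] (Fin 6 × Fin 6 → ZMod 2) where
  toFun v p := ∑ i, v i (B p i)
  map_add' v w := by
    funext p
    simp [Finset.sum_add_distrib]
  map_smul' c v := by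
    funext p
    simp [Finset.mul_sum]

theorem inc_dot {B : Fin 6 × Fin 6 → Fin 4 → Fin 6} (hB : IsOA B) (v w : Fin 4 → Fin 6 → ZMod 2) :
    inc B v ⬝ᵥ inc B w = ∑ i, ∑ j, if i = j then 0 else (∑ a, v i a) * (∑ a, w j a) := by
  have h1 : inc B v ⬝ᵥ inc B w = ∑ i, ∑ j, ∑ p, v i (B p i) * w j (B p j) := by
    simp only [dotProduct, inc, LinearMap.coe_mk, AddHom.coe_mk, Finset.sum_mul_sum]
    rw [Finset.sum_comm]
    refine Finset.sum_congr rfl fun i _ => ?_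
    rw [Finset.sum_comm]
  rw [h1]
  refine Finset.sum_congr rfl fun i _ => Finset.sum_congr rfl fun j _ => ?_
  split_ifs with h
  · subst h
    rw [sum_single hB i (fun a => v i a * w i a), nsmul_eq_mul]
    have : ((6 : ℕ) : ZMod 2) = 0 := by decide
    rw [this, zero_mul]
  · rw [sum_pair hB h (fun a b => v i a * w j b), Finset.sum_mul_sum]

/-- Five linear constraints on point weights. -/
def cons : (Fin 4 → Fin 6 → ZMod 2) →ₗ[ZMod 2] (Fin 5 → ZMod 2) where
  toFun v := ![∑ a, v 0 a - ∑ a, v 1 a, ∑ a, v 2 a - ∑ a, v 3 a, v 1 0, v 2 0, v 3 0]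
  map_add' v w := by
    funext k
    fin_cases k <;> simp [Finset.sum_add_distrib] <;> ring
  map_smul' c v := by
    funext k
    fin_cases k <;> simp [← Finset.mul_sum] <;> ring

theorem exists_dep {B : Fin 6 × Fin 6 → Fin 4 → Fin 6} (hB : IsOA B) :
    ∃ v : Fin 4 → Fin 6 → ZMod 2, v ≠ 0 ∧ inc B v = 0 ∧ v 1 0 = 0 ∧ v 2 0 = 0 ∧ v 3 0 = 0 := by
  by_contra hcon
  push Not at hcon
  let K := LinearMap.ker cons
  have hK : 19 ≤ Module.finrank (ZMod 2) K := by
    have h1 := LinearMap.finrank_range_add_finrank_ker cons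
    have h2 : Module.finrank (ZMod 2) (LinearMap.range cons) ≤ 5 := by
      have := Submodule.finrank_le (LinearMap.range cons)
      simpa using this
    have h3 : Module.finrank (ZMod 2) (Fin 4 → Fin 6 → ZMod 2) = 24 := by
      rw [Module.finrank_pi_fintype]
      simp
    change 19 ≤ Module.finrank (ZMod 2) (LinearMap.ker cons)
    omega
  have memK : ∀ v ∈ K, ∑ a, v 0 a = ∑ a, v 1 a ∧ ∑ a, v 2 a = ∑ a, v 3 a ∧
      v 1 0 = 0 ∧ v 2 0 = 0 ∧ v 3 0 = 0 := by
    intro v hv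
    have hv : cons v = 0 := hv
    have e := fun k => congrFun hv k
    have e0 := e 0
    have e1 := e 1
    have e2 := e 2
    have e3 := e 3
    have e4 := e 4
    simp only [cons, LinearMap.coe_mk, AddHom.coe_mk] at e0 e1 e2 e3 e4
    exact ⟨sub_eq_zero.1 e0, sub_eq_zero.1 e1, e2, e3, e4⟩
  let W := K.map (inc B)
  have hinj : Function.Injective ((inc B).domRestrict K) := by
    rw [← LinearMap.ker_eq_bot, LinearMap.ker_eq_bot']
    rintro ⟨v, hv⟩ h0
    obtain ⟨-, -, h1, h2, h3⟩ := memK v hv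
    by_contra hne
    exact hcon v (fun h => hne (Subtype.ext h)) h0 h1 h2 h3
  have hW : 19 ≤ Module.finrank (ZMod 2) W := by
    have := LinearMap.finrank_range_of_inj hinj
    rw [LinearMap.range_domRestrict] at this
    change 19 ≤ Module.finrank (ZMod 2) (K.map (inc B))
    omega
  let Q : LinearMap.BilinForm (ZMod 2) (Fin 6 × Fin 6 → ZMod 2) := Matrix.toBilin' 1
  have hQ : Q.Nondegenerate := by
    refine LinearMap.BilinForm.nondegenerate_toBilin'_of_det_ne_zero' _ ?_
    simp
  have hQa : ∀ x y, Q x y = x ⬝ᵥ y := by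
    intro x y
    simp [Q, Matrix.toBilin'_apply']
  have hle : W ≤ Q.orthogonal W := by
    rintro _ ⟨w, hw, rfl⟩ _ ⟨v, hv, rfl⟩
    rw [hQa, inc_dot hB]
    obtain ⟨a1, a2, -⟩ := memK v hv
    obtain ⟨b1, b2, -⟩ := memK w hw
    simp only [Fin.sum_univ_four, Fin.isValue, a1, a2, b1, b2]
    generalize ∑ a, v 1 a = x
    generalize ∑ a, v 3 a = y
    generalize ∑ a, w 1 a = x'
    generalize ∑ a, w 3 a = y'
    simp
    revert x y x' y'
    decide
  have h1 := Submodule.finrank_mono hle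
  rw [LinearMap.BilinForm.finrank_orthogonal hQ] at h1
  have h2 : Module.finrank (ZMod 2) (Fin 6 × Fin 6 → ZMod 2) = 36 := by simp
  omega

/-- Natural-number version of the dependency: an even set of points that is not a union
of groups, with few points in the first three groups. -/
theorem exists_even {B : Fin 6 × Fin 6 → Fin 4 → Fin 6} (hB : IsOA B) :
    ∃ u : Fin 4 → Fin 6 → ℕ, (∀ i a, u i a ≤ 1) ∧ (∀ p, Even (∑ i, u i (B p i))) ∧
      (∃ i a b, u i a ≠ u i b) ∧ ∀ i, i ≠ 3 → ∑ a, u i a ≤ 3 := by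
  obtain ⟨v, hv0, hv, h1, h2, h3⟩ := exists_dep hB
  have hne : ∃ i a b, v i a ≠ v i b := by
    by_contra hcon
    push Not at hcon
    apply hv0
    have e1 : ∀ a, v 1 a = 0 := fun a => (hcon 1 a 0).trans h1
    have e2 : ∀ a, v 2 a = 0 := fun a => (hcon 2 a 0).trans h2
    have e3 : ∀ a, v 3 a = 0 := fun a => (hcon 3 a 0).trans h3
    have e0 : ∀ a, v 0 a = 0 := by
      intro a
      have := congrFun hv (0, 0)
      simp only [inc, LinearMap.coe_mk, AddHom.coe_mk, Fin.sum_univ_four, e1, e2, e3,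
        Pi.zero_apply, add_zero] at this
      exact (hcon 0 a _).trans this
    funext i a
    fin_cases i
    · exact e0 a
    · exact e1 a
    · exact e2 a
    · exact e3 a
  -- complement
  let c : Fin 4 → ZMod 2 := fun i => if ∑ a, (v i a).val ≤ 3 then 0 else 1
  let t : Fin 4 → ZMod 2 := ![c 0, c 1, c 2, c 0 + c 1 + c 2]
  have ht : ∑ i, t i = 0 := by
    simp only [Fin.sum_univ_four, t]
    generalize c 0 = x
    generalize c 1 = y
    generalize c 2 = z
    revert x y z
    decide
  have ht' : ∀ i, i ≠ 3 → t i = c i := by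
    intro i hi
    fin_cases i <;> first | rfl | exact absurd rfl hi
  have hval : ∀ x : ZMod 2, (x + 1).val + x.val = 1 := by decide
  refine ⟨fun i a => (v i a + t i).val, ?_, ?_, ?_, ?_⟩
  · intro i a
    exact Nat.lt_succ_iff.1 (ZMod.val_lt (v i a + t i))
  · intro p
    rw [← ZMod.natCast_eq_zero_iff_even]
    push_cast
    simp only [ZMod.natCast_val, ZMod.cast_id', id_eq, Finset.sum_add_distrib, ht, add_zero]
    exact congrFun hv p
  · obtain ⟨i, a, b, hab⟩ := hne
    refine ⟨i, a, b, fun h => hab ?_⟩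
    exact add_right_cancel (ZMod.val_injective 2 h)
  · intro i hi
    simp only [ht' i hi, c]
    split_ifs with h
    · simpa using h
    · have : ∑ a, (v i a + 1).val + ∑ a, (v i a).val = 6 := by
        rw [← Finset.sum_add_distrib]
        simp [hval]
      omega

theorem card_through {B : Fin 6 × Fin 6 → Fin 4 → Fin 6} (hB : IsOA B) (i : Fin 4) (a : Fin 6) :
    (Finset.univ.filter fun p => B p i = a).card = 6 := by
  rw [Finset.card_filter, sum_single hB i (fun x => if x = a then 1 else 0)]
  simp

theorem sum_through {B : Fin 6 × Fin 6 → Fin 4 → Fin 6} (hB : IsOA B) (i : Fin 4) (a : Fin 6)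
    (u : Fin 4 → Fin 6 → ℕ) :
    ∑ p ∈ Finset.univ.filter (fun p => B p i = a), ∑ j, u j (B p j) =
      6 * u i a + ∑ j ∈ Finset.univ.erase i, ∑ b, u j b := by
  rw [Finset.sum_comm, ← Finset.add_sum_erase _ _ (Finset.mem_univ i)]
  congr 1
  · rw [Finset.sum_congr rfl (g := fun _ => u i a)]
    · rw [Finset.sum_const, card_through hB, smul_eq_mul]
    · intro p hp
      rw [(Finset.mem_filter.1 hp).2]
  · refine Finset.sum_congr rfl fun j hj => ?_
    rw [Finset.sum_filter, sum_pair hB (Finset.ne_of_mem_erase hj).symm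
      (fun x y => if x = a then u j y else 0)]
    rw [Finset.sum_eq_single a]
    · simp
    · intro b _ hb
      simp [hb]
    · simp

theorem sum_ge {B : Fin 6 × Fin 6 → Fin 4 → Fin 6} (hB : IsOA B) {u : Fin 4 → Fin 6 → ℕ}
    (he : ∀ p, Even (∑ i, u i (B p i))) {i : Fin 4} {a : Fin 6} (ha : u i a = 1) :
    6 ≤ ∑ j ∈ Finset.univ.erase i, ∑ b, u j b ∧
    (∑ j ∈ Finset.univ.erase i, ∑ b, u j b = 6 → ∀ p, B p i = a → ∑ j, u j (B p j) = 2) := by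
  have h2 : ∀ p ∈ Finset.univ.filter (fun p => B p i = a), 2 ≤ ∑ j, u j (B p j) := by
    intro p hp
    have hp := (Finset.mem_filter.1 hp).2
    have h1 : u i (B p i) ≤ ∑ j, u j (B p j) :=
      Finset.single_le_sum (f := fun j => u j (B p j)) (fun _ _ => Nat.zero_le _) (Finset.mem_univ i)
    rw [hp, ha] at h1
    obtain ⟨k, hk⟩ := he p
    omega
  have hs := sum_through hB i a u
  have hc : ∑ p ∈ Finset.univ.filter (fun p => B p i = a), 2 = 12 := by
    rw [Finset.sum_const, card_through hB]; rfl
  have hle := Finset.sum_le_sum h2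
  refine ⟨by omega, fun h6 p hp => ?_⟩
  have heq := (Finset.sum_eq_sum_iff_of_le h2).1 (by omega)
  exact (heq p (by simp [hp])).symm

theorem exists_special {B : Fin 6 × Fin 6 → Fin 4 → Fin 6} (hB : IsOA B) :
    ∃ u : Fin 4 → Fin 6 → ℕ, (∀ i a, u i a ≤ 1) ∧ (∀ i, ∑ a, u i a = 2) ∧
      (∀ p, ∑ i, u i (B p i) = 0 ∨ ∑ i, u i (B p i) = 2) := by
  obtain ⟨u, hu, he, ⟨i₀, a₀, b₀, hab⟩, h3⟩ := exists_even hB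
  have hpar : ∀ i, Even (∑ j ∈ Finset.univ.erase i, ∑ b, u j b) := by
    intro i
    have hs := sum_through hB i 0 u
    have h1 : Even (∑ p ∈ Finset.univ.filter (fun p => B p i = 0), ∑ j, u j (B p j)) :=
      Finset.even_sum _ fun p _ => he p
    rw [hs] at h1
    obtain ⟨k, hk⟩ := h1
    exact ⟨k - 3 * u i 0, by omega⟩
  have E0 : ∀ f : Fin 4 → ℕ, ∑ j ∈ Finset.univ.erase 0, f j = f 1 + f 2 + f 3 := by
    intro f
    have := Finset.add_sum_erase Finset.univ f (Finset.mem_univ 0)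
    rw [Fin.sum_univ_four] at this; omega
  have E1 : ∀ f : Fin 4 → ℕ, ∑ j ∈ Finset.univ.erase 1, f j = f 0 + f 2 + f 3 := by
    intro f
    have := Finset.add_sum_erase Finset.univ f (Finset.mem_univ 1)
    rw [Fin.sum_univ_four] at this; omega
  have E2 : ∀ f : Fin 4 → ℕ, ∑ j ∈ Finset.univ.erase 2, f j = f 0 + f 1 + f 3 := by
    intro f
    have := Finset.add_sum_erase Finset.univ f (Finset.mem_univ 2)
    rw [Fin.sum_univ_four] at this; omega
  have E3 : ∀ f : Fin 4 → ℕ, ∑ j ∈ Finset.univ.erase 3, f j = f 0 + f 1 + f 2 := by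
    intro f
    have := Finset.add_sum_erase Finset.univ f (Finset.mem_univ 3)
    rw [Fin.sum_univ_four] at this; omega
  have hge : ∀ i, ∑ b, u i b ≠ 0 → ∃ a, u i a = 1 := by
    intro i hi
    obtain ⟨a, -, ha⟩ := Finset.exists_ne_zero_of_sum_ne_zero hi
    exact ⟨a, by have := hu i a; omega⟩
  have hi₀ : ∑ b, u i₀ b ≠ 0 := by
    intro h
    rw [Finset.sum_eq_zero_iff] at h
    exact hab ((h a₀ (Finset.mem_univ _)).trans (h b₀ (Finset.mem_univ _)).symm)
  have key : ∀ i, ∑ b, u i b ≠ 0 → 6 ≤ ∑ j ∈ Finset.univ.erase i, ∑ b, u j b := by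
    intro i hi
    obtain ⟨a, ha⟩ := hge i hi
    exact (sum_ge hB he ha).1
  have p0 := hpar 0
  have p1 := hpar 1
  have p2 := hpar 2
  have p3 := hpar 3
  have k0 := key 0
  have k1 := key 1
  have k2 := key 2
  have k3 := key 3
  have t0 := h3 0 (by decide)
  have t1 := h3 1 (by decide)
  have t2 := h3 2 (by decide)
  rw [E0] at p0 k0
  rw [E1] at p1 k1
  rw [E2] at p2 k2
  rw [E3] at p3 k3
  rw [Nat.even_iff] at p0 p1 p2 p3
  have hsum : ∑ b, u 0 b ≠ 0 ∨ ∑ b, u 1 b ≠ 0 ∨ ∑ b, u 2 b ≠ 0 ∨ ∑ b, u 3 b ≠ 0 := by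
    fin_cases i₀
    · exact Or.inl hi₀
    · exact Or.inr (Or.inl hi₀)
    · exact Or.inr (Or.inr (Or.inl hi₀))
    · exact Or.inr (Or.inr (Or.inr hi₀))
  have hm : ∑ b, u 0 b = 2 ∧ ∑ b, u 1 b = 2 ∧ ∑ b, u 2 b = 2 ∧ ∑ b, u 3 b ≠ 0 := by omega
  obtain ⟨m0, m1, m2, m3⟩ := hm
  -- no block has four special points
  have hno : ∀ p, u 3 (B p 3) = 1 → ∑ j, u j (B p j) = 2 := by
    intro p hp
    exact (sum_ge hB he hp).2 (by rw [E3]; omega) p rfl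
  have hm3 : ∑ b, u 3 b = 2 := by
    obtain ⟨a, ha⟩ := hge 0 (by omega)
    have hs := sum_through hB 0 a u
    rw [E0, ha] at hs
    have : ∑ p ∈ Finset.univ.filter (fun p => B p 0 = a), ∑ j, u j (B p j) ≤
        ∑ p ∈ Finset.univ.filter (fun p => B p 0 = a), 2 := by
      refine Finset.sum_le_sum fun p hp => ?_
      have := hu 0 (B p 0)
      have := hu 1 (B p 1)
      have := hu 2 (B p 2)
      have := hu 3 (B p 3)
      have h4 := hno p
      have h5 := he p
      rw [Nat.even_iff] at h5
      rw [Fin.sum_univ_four] at *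
      omega
    rw [Finset.sum_const, card_through hB, smul_eq_mul] at this
    omega
  refine ⟨u, hu, ?_, ?_⟩
  · intro i
    fin_cases i
    · exact m0
    · exact m1
    · exact m2
    · exact hm3
  · intro p
    have := hu 0 (B p 0)
    have := hu 1 (B p 1)
    have := hu 2 (B p 2)
    have := hu 3 (B p 3)
    have h4 := hno p
    have h5 := he p
    rw [Nat.even_iff] at h5
    rw [Fin.sum_univ_four] at *
    omega

theorem exists_two {w : Fin 6 → ℕ} (hw : ∀ a, w a ≤ 1) (hs : ∑ a, w a = 2) :
    ∃ y : Fin 2 → Fin 6, y 0 ≠ y 1 ∧ w (y 0) = 1 ∧ w (y 1) = 1 ∧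
      ∀ a, w a = 1 → a = y 0 ∨ a = y 1 := by
  have h1 : (Finset.univ.filter fun a => w a = 1).card = 2 := by
    rw [Finset.card_filter, ← hs]
    refine Finset.sum_congr rfl fun a _ => ?_
    have := hw a
    split_ifs <;> omega
  obtain ⟨x, y, hxy, h⟩ := Finset.card_eq_two.1 h1
  have hm : ∀ a, w a = 1 ↔ a = x ∨ a = y := by
    intro a
    have : a ∈ (Finset.univ.filter fun a => w a = 1) ↔ a ∈ ({x, y} : Finset (Fin 6)) := by rw [h]
    simpa using this
  exact ⟨![x, y], hxy, (hm x).2 (Or.inl rfl), (hm y).2 (Or.inr rfl), fun a ha => (hm a).1 ha⟩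

theorem pigeon {α : Type*} {a b x y z : α} (hx : x = a ∨ x = b) (hy : y = a ∨ y = b)
    (hz : z = a ∨ z = b) (h : y ≠ z) : x = y ∨ x = z := by
  rcases hy with rfl | rfl
  · rcases hz with rfl | rfl
    · exact absurd rfl h
    · exact hx
  · rcases hz with rfl | rfl
    · exact hx.symm
    · exact absurd rfl h

theorem block_inj {B : Fin 6 × Fin 6 → Fin 4 → Fin 6} (hB : IsOA B) {u : Fin 4 → Fin 6 → ℕ}
    (y : Fin 4 → Fin 2 → Fin 6) (hy0 : ∀ i, u i (y i 0) = 1)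
    (hyy : ∀ i a, u i a = 1 → a = y i 0 ∨ a = y i 1)
    {i j k l : Fin 4} (hik : i ≠ k) (hjk : j ≠ k) (hkl : k ≠ l)
    (hT : ∀ p, u i (B p i) + u j (B p j) + u k (B p k) + u l (B p l) = 0 ∨
      u i (B p i) + u j (B p j) + u k (B p k) + u l (B p l) = 2)
    {p q : Fin 6 × Fin 6} (hpi : u i (B p i) = 1) (hpj : u j (B p j) = 1)
    (hqi : u i (B q i) = 1) (hqj : u j (B q j) = 1) (hk : B p k = B q k) : p = q := by
  have oai : ∀ r s, B r i = B s i → B r k = B s k → r = s := fun r s h1 h2 =>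
    (hB i k hik).1 (Prod.ext h1 h2)
  have oaj : ∀ r s, B r j = B s j → B r k = B s k → r = s := fun r s h1 h2 =>
    (hB j k hjk).1 (Prod.ext h1 h2)
  by_contra hne
  have hi : B p i ≠ B q i := fun h => hne (oai p q h hk)
  have hj : B p j ≠ B q j := fun h => hne (oaj p q h hk)
  obtain ⟨r, hr⟩ := (hB k l hkl).2 (B p k, y l 0)
  rw [Prod.mk.injEq] at hr
  obtain ⟨hrk, hrl⟩ := hr
  have hrl1 : u l (B r l) = 1 := by rw [hrl]; exact hy0 l
  have hpk : u k (B p k) = 0 := by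
    have := hT p
    omega
  have hrk0 : u k (B r k) = 0 := by rw [hrk]; exact hpk
  have hrp : r ≠ p := by
    rintro rfl
    have := hT r
    omega
  have hrq : r ≠ q := by
    rintro rfl
    have := hT r
    omega
  have hor : u i (B r i) = 1 ∨ u j (B r j) = 1 := by
    have := hT r
    omega
  rcases hor with h | h
  · have h1 := hyy i _ h
    have h2 := hyy i _ hpi
    have h3 := hyy i _ hqi
    have : B r i = B p i ∨ B r i = B q i := pigeon h1 h2 h3 hi
    rcases this with h4 | h4
    · exact hrp (oai r p h4 hrk)
    · exact hrq (oai r q h4 (hrk.trans hk))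
  · have h1 := hyy j _ h
    have h2 := hyy j _ hpj
    have h3 := hyy j _ hqj
    have : B r j = B p j ∨ B r j = B q j := pigeon h1 h2 h3 hj
    rcases this with h4 | h4
    · exact hrp (oaj r p h4 hrk)
    · exact hrq (oaj r q h4 (hrk.trans hk))

/-- The relabelling of one group. -/
def groupMap (y : Fin 2 → Fin 6) (z : Fin 2 → Fin 2 → Fin 6) : Fin 6 → Fin 6 :=
  ![y 0, y 1, z 0 0, z 0 1, z 1 0, z 1 1]

theorem groupMap_weight {w : Fin 6 → ℕ} {y : Fin 2 → Fin 6} {z : Fin 2 → Fin 2 → Fin 6}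
    (hy0 : w (y 0) = 1) (hy1 : w (y 1) = 1) (hz : ∀ a b, w (z a b) = 0) (x : Fin 6) :
    w (groupMap y z x) = (Nat.ble x 1).toNat := by
  fin_cases x
  · exact hy0
  · exact hy1
  · exact hz 0 0
  · exact hz 0 1
  · exact hz 1 0
  · exact hz 1 1

theorem groupMap_inj {w : Fin 6 → ℕ} {y : Fin 2 → Fin 6} {z : Fin 2 → Fin 2 → Fin 6}
    (hy : y 0 ≠ y 1)
    (hy0 : w (y 0) = 1) (hy1 : w (y 1) = 1) (hz : ∀ a b, w (z a b) = 0)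
    (hzi : ∀ a b a' b', z a b = z a' b' → a = a' ∧ b = b') :
    Function.Injective (groupMap y z) := by
  have d0 : ∀ a b, y 0 ≠ z a b := by
    intro a b h
    have := hz a b
    rw [← h, hy0] at this
    omega
  have d1 : ∀ a b, y 1 ≠ z a b := by
    intro a b h
    have := hz a b
    rw [← h, hy1] at this
    omega
  have e1 : z 0 0 ≠ z 0 1 := fun h => absurd (hzi _ _ _ _ h).2 (by decide)
  have e2 : z 0 0 ≠ z 1 0 := fun h => absurd (hzi _ _ _ _ h).1 (by decide)
  have e3 : z 0 0 ≠ z 1 1 := fun h => absurd (hzi _ _ _ _ h).1 (by decide)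
  have e4 : z 0 1 ≠ z 1 0 := fun h => absurd (hzi _ _ _ _ h).1 (by decide)
  have e5 : z 0 1 ≠ z 1 1 := fun h => absurd (hzi _ _ _ _ h).1 (by decide)
  have e6 : z 1 0 ≠ z 1 1 := fun h => absurd (hzi _ _ _ _ h).2 (by decide)
  have hlt : ∀ i j : Fin 6, i < j → groupMap y z i ≠ groupMap y z j := by
    intro i j hij
    fin_cases i <;> fin_cases j <;> first
      | exact absurd hij (by decide)
      | exact hy
      | exact d0 _ _
      | exact d1 _ _
      | exact e1
      | exact e2
      | exact e3
      | exact e4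
      | exact e5
      | exact e6
  intro i j h
  rcases lt_trichotomy i j with hij | hij | hij
  · exact absurd h (hlt i j hij)
  · exact hij
  · exact absurd h.symm (hlt j i hij)

theorem no_OA (B : Fin 6 × Fin 6 → Fin 4 → Fin 6) (hB : IsOA B) : False := by
  obtain ⟨u, hu, hs, hT⟩ := exists_special hB
  choose y hy hy0 hy1 hyy using fun i => exists_two (hu i) (hs i)
  have hya : ∀ i a, u i (y i a) = 1 := by
    intro i a
    fin_cases a
    · exact hy0 i
    · exact hy1 i
  have hyinj : ∀ i a a', y i a = y i a' → a = a' := by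
    intro i a a' h
    fin_cases a <;> fin_cases a'
    · rfl
    · exact absurd h (hy i)
    · exact absurd h.symm (hy i)
    · rfl
  choose p hp using fun a b => (hB 0 1 (by decide)).2 (y 0 a, y 1 b)
  choose q hq using fun a b => (hB 2 3 (by decide)).2 (y 2 a, y 3 b)
  simp only [Prod.mk.injEq] at hp hq
  simp only [Fin.sum_univ_four] at hT
  have pw0 : ∀ a b, u 0 (B (p a b) 0) = 1 := fun a b => by rw [(hp a b).1]; exact hya _ _
  have pw1 : ∀ a b, u 1 (B (p a b) 1) = 1 := fun a b => by rw [(hp a b).2]; exact hya _ _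
  have qw2 : ∀ a b, u 2 (B (q a b) 2) = 1 := fun a b => by rw [(hq a b).1]; exact hya _ _
  have qw3 : ∀ a b, u 3 (B (q a b) 3) = 1 := fun a b => by rw [(hq a b).2]; exact hya _ _
  have pinj : ∀ a b a' b', p a b = p a' b' → a = a' ∧ b = b' := by
    intro a b a' b' h
    have h0 := (hp a b).1
    have h1 := (hp a b).2
    rw [h] at h0 h1
    exact ⟨hyinj 0 _ _ (h0.symm.trans (hp a' b').1), hyinj 1 _ _ (h1.symm.trans (hp a' b').2)⟩
  have qinj : ∀ a b a' b', q a b = q a' b' → a = a' ∧ b = b' := by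
    intro a b a' b' h
    have h0 := (hq a b).1
    have h1 := (hq a b).2
    rw [h] at h0 h1
    exact ⟨hyinj 2 _ _ (h0.symm.trans (hq a' b').1), hyinj 3 _ _ (h1.symm.trans (hq a' b').2)⟩
  let z : Fin 4 → Fin 2 → Fin 2 → Fin 6 :=
    ![fun a b => B (q a b) 0, fun a b => B (q a b) 1, fun a b => B (p a b) 2, fun a b => B (p a b) 3]
  have hzw : ∀ i a b, u i (z i a b) = 0 := by
    intro i a b
    have h1 := hT (p a b)
    have h2 := hT (q a b)
    rw [pw0, pw1] at h1
    rw [qw2, qw3] at h2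
    fin_cases i
    · change u 0 (B (q a b) 0) = 0
      omega
    · change u 1 (B (q a b) 1) = 0
      omega
    · change u 2 (B (p a b) 2) = 0
      omega
    · change u 3 (B (p a b) 3) = 0
      omega
  have hzi : ∀ i a b a' b', z i a b = z i a' b' → a = a' ∧ b = b' := by
    intro i a b a' b' h
    fin_cases i
    · exact qinj _ _ _ _ (block_inj hB y hy0 hyy (i := 2) (j := 3) (k := 0) (l := 1)
        (by decide) (by decide) (by decide) (fun r => by have := hT r; omega)
        (qw2 _ _) (qw3 _ _) (qw2 _ _) (qw3 _ _) h)
    · exact qinj _ _ _ _ (block_inj hB y hy0 hyy (i := 2) (j := 3) (k := 1) (l := 0)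
        (by decide) (by decide) (by decide) (fun r => by have := hT r; omega)
        (qw2 _ _) (qw3 _ _) (qw2 _ _) (qw3 _ _) h)
    · exact pinj _ _ _ _ (block_inj hB y hy0 hyy (i := 0) (j := 1) (k := 2) (l := 3)
        (by decide) (by decide) (by decide) (fun r => by have := hT r; omega)
        (pw0 _ _) (pw1 _ _) (pw0 _ _) (pw1 _ _) h)
    · exact pinj _ _ _ _ (block_inj hB y hy0 hyy (i := 0) (j := 1) (k := 3) (l := 2)
        (by decide) (by decide) (by decide) (fun r => by have := hT r; omega)
        (pw0 _ _) (pw1 _ _) (pw0 _ _) (pw1 _ _) h)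
  let σ : Fin 4 → (Fin 6 ≃ Fin 6) := fun i =>
    Equiv.ofBijective (groupMap (y i) (z i)) (Finite.injective_iff_bijective.1
      (groupMap_inj (hy i) (hy0 i) (hy1 i) (hzw i) (hzi i)))
  have hσ : ∀ i x, σ i x = groupMap (y i) (z i) x := fun i x => rfl
  let B' : Fin 6 × Fin 6 → Fin 4 → Fin 6 := fun r i => (σ i).symm (B r i)
  have hw : ∀ r i, (Nat.ble (B' r i) 1).toNat = u i (B r i) := by
    intro r i
    rw [← groupMap_weight (hy0 i) (hy1 i) (hzw i), ← hσ]
    simp only [B', Equiv.apply_symm_apply]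
  have henc : ∀ r (x0 x1 x2 x3 : Fin 6), B r 0 = groupMap (y 0) (z 0) x0 →
      B r 1 = groupMap (y 1) (z 1) x1 → B r 2 = groupMap (y 2) (z 2) x2 →
      B r 3 = groupMap (y 3) (z 3) x3 → enc (B' r) = ((x0 : ℕ), (x1 : ℕ), (x2 : ℕ), (x3 : ℕ)) := by
    intro r x0 x1 x2 x3 h0 h1 h2 h3
    simp only [enc, B']
    rw [h0, h1, h2, h3, ← hσ, ← hσ, ← hσ, ← hσ]
    simp only [Equiv.symm_apply_apply]
  refine final (B := B') ?_ ?_ ?_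
  · intro i j hij
    exact (((σ i).symm.bijective).prodMap ((σ j).symm.bijective)).comp (hB i j hij)
  · intro r
    simp only [evenOk, enc, hw]
    rcases hT r with h | h <;> rw [h] <;> rfl
  · intro t ht
    simp only [preset, List.mem_cons, List.not_mem_nil, or_false] at ht
    rcases ht with rfl | rfl | rfl | rfl | rfl | rfl | rfl | rfl
    · exact ⟨p 0 0, henc _ 0 0 2 2 (hp 0 0).1 (hp 0 0).2 rfl rfl⟩
    · exact ⟨p 0 1, henc _ 0 1 3 3 (hp 0 1).1 (hp 0 1).2 rfl rfl⟩
    · exact ⟨p 1 0, henc _ 1 0 4 4 (hp 1 0).1 (hp 1 0).2 rfl rfl⟩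
    · exact ⟨p 1 1, henc _ 1 1 5 5 (hp 1 1).1 (hp 1 1).2 rfl rfl⟩
    · exact ⟨q 0 0, henc _ 2 2 0 0 rfl rfl (hq 0 0).1 (hq 0 0).2⟩
    · exact ⟨q 0 1, henc _ 3 3 0 1 rfl rfl (hq 0 1).1 (hq 0 1).2⟩
    · exact ⟨q 1 0, henc _ 4 4 1 0 rfl rfl (hq 1 0).1 (hq 1 0).2⟩
    · exact ⟨q 1 1, henc _ 5 5 1 1 rfl rfl (hq 1 1).1 (hq 1 1).2⟩

theorem support_surj {ψ : (Fin 4 → Fin 6) → ℂ} (h : IsAME 4 6 ψ) {i j : Fin 4} (hij : i ≠ j)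
    (a b : Fin 6) : ∃ s, ψ s ≠ 0 ∧ s i = a ∧ s j = b := by
  have hc : ({i, j} : Finset (Fin 4)).card = 2 := Finset.card_pair hij
  let β : {k : Fin 4 // k ∈ ({i, j} : Finset (Fin 4))} → Fin 6 := fun k => if k.1 = i then a else b
  have h1 := h.2 {i, j} (by rw [hc]) β β
  rw [if_pos rfl, hc] at h1
  have h2 : (∑ x : {k : Fin 4 // k ∉ ({i, j} : Finset (Fin 4))} → Fin 6,
      ψ (combine {i, j} x β) * (starRingEnd ℂ) (ψ (combine {i, j} x β))) ≠ 0 := by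
    rw [h1]
    norm_num
  obtain ⟨x, -, hx⟩ := Finset.exists_ne_zero_of_sum_ne_zero h2
  refine ⟨combine {i, j} x β, left_ne_zero_of_mul hx, ?_, ?_⟩
  · simp [combine, β]
  · simp [combine, β, hij.symm]

/-- There is no `AME(4,6)` state of minimal support. -/
theorem no_ame_4_6_minimal :
    ¬ ∃ ψ : (Fin 4 → Fin 6) → ℂ,
        IsAME 4 6 ψ ∧ {s : Fin 4 → Fin 6 | ψ s ≠ 0}.ncard = 36 := by

  rintro ⟨ψ, h, hcard⟩
  choose B hB hB0 hB1 using fun p : Fin 6 × Fin 6 =>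
    support_surj h (i := 0) (j := 1) (by decide) p.1 p.2
  have hinj : Function.Injective B := by
    intro p q hpq
    refine Prod.ext ?_ ?_
    · rw [← hB0 p, ← hB0 q, hpq]
    · rw [← hB1 p, ← hB1 q, hpq]
  have hr : Set.range B = {s | ψ s ≠ 0} := by
    refine Set.eq_of_subset_of_ncard_le ?_ ?_ (Set.toFinite _)
    · rintro _ ⟨p, rfl⟩
      exact hB p
    · rw [hcard, ← Set.image_univ, Set.ncard_image_of_injective _ hinj, Set.ncard_univ]
      simp
  refine no_OA B fun i j hij => Finite.surjective_iff_bijective.1 ?_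
  rintro ⟨a, b⟩
  obtain ⟨s, hs, hi, hj⟩ := support_surj h hij a b
  have : s ∈ Set.range B := by
    rw [hr]
    exact hs
  obtain ⟨p, rfl⟩ := this
  exact ⟨p, Prod.ext hi hj⟩

end AMEPaper
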